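/- Let D be a positive integer and let Γ ⊆ ℝ^D be a compact, convex, orthosymmetric set. Then for every ε > 0, n_gof(Γ, ε/√2)² ≥ (1/(64·log(2D))) · n_est(Γ, ε)/ε². -/

import Mathlib

open MeasureTheory ProbabilityTheory Real

/-- The standard multivariate Gaussian `N(θ, I_D)` on `ℝ^D`, as a product of
one-dimensional Gaussians with unit variance. -/
noncomputable def gaussPi {D : ℕ} (θ : Fin D → ℝ) : Measure (Fin D → ℝ) :=
  Measure.pi (fun i => gaussianReal (θ i) 1)

/-- The joint law of `n` i.i.d. samples from `ν`. -/
noncomputable def iidSamples {E : Type*} [MeasurableSpace E] (n : ℕ) (ν : Measure E) :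
    Measure (Fin n → E) :=
  Measure.pi (fun _ => ν)

/-- Euclidean norm on `ℝ^D`. -/
noncomputable def euclNorm {D : ℕ} (θ : Fin D → ℝ) : ℝ :=
  Real.sqrt (∑ i, (θ i) ^ 2)

/-- A set `Γ ⊆ ℝ^D` is orthosymmetric if it is closed under coordinatewise sign flips. -/
def Orthosymmetric {D : ℕ} (Γ : Set (Fin D → ℝ)) : Prop :=
  ∀ θ ∈ Γ, ∀ s : Fin D → ℝ, (∀ i, s i = 1 ∨ s i = -1) → (fun i => s i * θ i) ∈ Γ

/-- Goodness-of-fit sample complexity: the smallest `n` for which there is a measurable test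
`ψ` with type-I error at most `1/4` under `N(0, I_D)` and type-II error at most `1/4` under
every `N(θ, I_D)` with `θ ∈ Γ`, `‖θ‖₂ ≥ ε`. -/
noncomputable def nGof {D : ℕ} (Γ : Set (Fin D → ℝ)) (ε : ℝ) : ℕ :=
  sInf {n : ℕ | ∃ ψ : (Fin n → (Fin D → ℝ)) → Bool, Measurable ψ ∧
    (iidSamples n (gaussPi (0 : Fin D → ℝ))) {x | ψ x = true} ≤ 1/4 ∧
    ∀ θ ∈ Γ, ε ≤ euclNorm θ →
      (iidSamples n (gaussPi θ)) {x | ψ x = false} ≤ 1/4}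

/-- Estimation sample complexity: the smallest `n` for which there is a measurable estimator
whose worst-case expected squared Euclidean error over `Γ` is at most `ε²`. -/
noncomputable def nEst {D : ℕ} (Γ : Set (Fin D → ℝ)) (ε : ℝ) : ℕ :=
  sInf {n : ℕ | ∃ est : (Fin n → (Fin D → ℝ)) → (Fin D → ℝ), Measurable est ∧
    ∀ θ ∈ Γ,
      (∫⁻ x, ENNReal.ofReal (∑ i, (est x i - θ i) ^ 2) ∂(iidSamples n (gaussPi θ)))
        ≤ ENNReal.ofReal (ε ^ 2)}

section LikelihoodRatio

theorem lintegral_pi_prod {ι : Type*} [Fintype ι] {E : ι → Type*} [∀ i, MeasurableSpace (E i)]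
    (μ : ∀ i, Measure (E i)) [∀ i, IsProbabilityMeasure (μ i)] {f : ∀ i, E i → ENNReal}
    (hf : ∀ i, Measurable (f i)) :
    ∫⁻ x, ∏ i, f i (x i) ∂(Measure.pi μ) = ∏ i, ∫⁻ y, f i y ∂(μ i) := by
  rw [lintegral_prod_eq_prod_lintegral_of_indepFun Finset.univ (fun i (x : ∀ i, E i) => f i (x i))
    (iIndepFun_pi fun i => (hf i).aemeasurable)
    (fun i => (hf i).comp (measurable_pi_apply i))]
  refine Finset.prod_congr rfl fun i _ => ?_
  exact (measurePreserving_eval μ i).lintegral_comp (hf i)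

theorem pi_withDensity_eq {ι : Type*} [Fintype ι] {E : ι → Type*} [∀ i, MeasurableSpace (E i)]
    (μ : ∀ i, Measure (E i)) [∀ i, IsProbabilityMeasure (μ i)] {f : ∀ i, E i → ENNReal}
    (hf : ∀ i, Measurable (f i)) [∀ i, IsProbabilityMeasure ((μ i).withDensity (f i))] :
    Measure.pi (fun i => (μ i).withDensity (f i))
      = (Measure.pi μ).withDensity (fun x => ∏ i, f i (x i)) := by
  classical
  refine Measure.pi_eq fun s hs => ?_
  rw [withDensity_apply _ (MeasurableSet.univ_pi hs),
    ← lintegral_indicator (MeasurableSet.univ_pi hs)]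
  have h : ∀ x : ∀ i, E i, (Set.univ.pi s).indicator (fun x => ∏ i, f i (x i)) x
      = ∏ i, (s i).indicator (f i) (x i) := by
    intro x
    by_cases hx : x ∈ Set.univ.pi s
    · rw [Set.indicator_of_mem hx]
      exact Finset.prod_congr rfl fun i _ =>
        (Set.indicator_of_mem (hx i (Set.mem_univ i)) _).symm
    · rw [Set.indicator_of_notMem hx]
      simp only [Set.mem_pi, Set.mem_univ, true_implies, not_forall] at hx
      obtain ⟨i, hi⟩ := hx
      exact (Finset.prod_eq_zero (Finset.mem_univ i) (Set.indicator_of_notMem hi _)).symm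
  simp_rw [h]
  rw [lintegral_pi_prod μ fun i => (hf i).indicator (hs i)]
  refine Finset.prod_congr rfl fun i _ => ?_
  rw [withDensity_apply _ (hs i), lintegral_indicator (hs i)]

theorem gaussianReal_eq_withDensity (a : ℝ) :
    gaussianReal a 1
      = (gaussianReal 0 1).withDensity (fun x => ENNReal.ofReal (exp (a * x - a ^ 2 / 2))) := by
  rw [gaussianReal_of_var_ne_zero _ one_ne_zero, gaussianReal_of_var_ne_zero _ one_ne_zero,
    ← withDensity_mul _ (measurable_gaussianPDF 0 1) (by fun_prop)]
  congr 1
  ext x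
  rw [Pi.mul_apply, gaussianPDF, gaussianPDF, ← ENNReal.ofReal_mul (gaussianPDFReal_nonneg _ _ _),
    gaussianPDFReal, gaussianPDFReal, mul_assoc (√(2 * π * _))⁻¹, ← exp_add]
  congr 3
  push_cast
  ring

/-- The likelihood ratio of `n` samples of `N(θ, I_D)` against `n` samples of `N(0, I_D)`. -/
noncomputable def likelihoodRatio {D n : ℕ} (θ : Fin D → ℝ) (x : Fin n → Fin D → ℝ) : ℝ :=
  exp (∑ k, ∑ i, (θ i * x k i - θ i ^ 2 / 2))

variable {D n : ℕ}

theorem likelihoodRatio_pos (θ : Fin D → ℝ) (x : Fin n → Fin D → ℝ) :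
    0 < likelihoodRatio θ x := exp_pos _

@[fun_prop]
theorem measurable_likelihoodRatio (θ : Fin D → ℝ) :
    Measurable (likelihoodRatio (n := n) θ) := by
  unfold likelihoodRatio
  fun_prop

instance isProbabilityMeasure_gaussPi (θ : Fin D → ℝ) : IsProbabilityMeasure (gaussPi θ) := by
  unfold gaussPi
  infer_instance

instance isProbabilityMeasure_iidSamples (θ : Fin D → ℝ) :
    IsProbabilityMeasure (iidSamples n (gaussPi θ)) := by
  unfold iidSamples
  infer_instance

theorem gaussPi_eq_withDensity (θ : Fin D → ℝ) :
    gaussPi θ = (gaussPi 0).withDensity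
      (fun x => ENNReal.ofReal (exp (∑ i, (θ i * x i - θ i ^ 2 / 2)))) := by
  have hprob : ∀ i, IsProbabilityMeasure ((gaussianReal 0 1).withDensity
      (fun x => ENNReal.ofReal (exp (θ i * x - θ i ^ 2 / 2)))) := fun i => by
    rw [← gaussianReal_eq_withDensity]
    infer_instance
  unfold gaussPi
  simp_rw [fun i => gaussianReal_eq_withDensity (θ i)]
  rw [pi_withDensity_eq (fun _ => gaussianReal 0 1) (by fun_prop)]
  congr 1
  ext x
  rw [exp_sum, ENNReal.ofReal_prod_of_nonneg fun i _ => (exp_pos _).le]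

theorem iidSamples_eq_withDensity (θ : Fin D → ℝ) :
    iidSamples n (gaussPi θ) = (iidSamples n (gaussPi 0)).withDensity
      (fun x => ENNReal.ofReal (likelihoodRatio θ x)) := by
  have hprob : IsProbabilityMeasure ((gaussPi 0).withDensity
      (fun x => ENNReal.ofReal (exp (∑ i, (θ i * x i - θ i ^ 2 / 2))))) := by
    rw [← gaussPi_eq_withDensity]
    infer_instance
  unfold iidSamples
  rw [gaussPi_eq_withDensity θ, pi_withDensity_eq (fun _ => gaussPi 0) (by fun_prop)]
  congr 1
  ext x
  rw [likelihoodRatio, exp_sum, ENNReal.ofReal_prod_of_nonneg fun i _ => (exp_pos _).le]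

theorem lintegral_likelihoodRatio (θ : Fin D → ℝ) :
    ∫⁻ x, ENNReal.ofReal (likelihoodRatio θ x) ∂(iidSamples n (gaussPi 0)) = 1 := by
  rw [← setLIntegral_univ, ← withDensity_apply _ MeasurableSet.univ,
    ← iidSamples_eq_withDensity, measure_univ]

theorem integrable_likelihoodRatio (θ : Fin D → ℝ) :
    Integrable (likelihoodRatio θ) (iidSamples n (gaussPi 0)) := by
  refine ⟨(measurable_likelihoodRatio θ).aestronglyMeasurable, ?_⟩
  rw [hasFiniteIntegral_iff_ofReal (.of_forall fun x => (likelihoodRatio_pos θ x).le),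
    lintegral_likelihoodRatio]
  exact ENNReal.one_lt_top

theorem integral_likelihoodRatio (θ : Fin D → ℝ) :
    ∫ x, likelihoodRatio θ x ∂(iidSamples n (gaussPi 0)) = 1 := by
  rw [integral_eq_lintegral_of_nonneg_ae (.of_forall fun x => (likelihoodRatio_pos θ x).le)
    (measurable_likelihoodRatio θ).aestronglyMeasurable, lintegral_likelihoodRatio,
    ENNReal.toReal_one]

theorem setIntegral_likelihoodRatio (θ : Fin D → ℝ) {A : Set (Fin n → Fin D → ℝ)}
    (hA : MeasurableSet A) :
    ∫ x in A, likelihoodRatio θ x ∂(iidSamples n (gaussPi 0))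
      = (iidSamples n (gaussPi θ)).real A := by
  rw [integral_eq_lintegral_of_nonneg_ae (.of_forall fun x => (likelihoodRatio_pos θ x).le)
    (measurable_likelihoodRatio θ).aestronglyMeasurable, ← withDensity_apply _ hA,
    ← iidSamples_eq_withDensity, Measure.real]

theorem likelihoodRatio_mul (a b : Fin D → ℝ) (x : Fin n → Fin D → ℝ) :
    likelihoodRatio a x * likelihoodRatio b x
      = exp (n * ∑ i, a i * b i) * likelihoodRatio (a + b) x := by
  have h : (n : ℝ) * ∑ i, a i * b i = ∑ _k : Fin n, ∑ i, a i * b i := by simp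
  rw [likelihoodRatio, likelihoodRatio, likelihoodRatio, ← exp_add, ← exp_add, h,
    ← Finset.sum_add_distrib, ← Finset.sum_add_distrib]
  congr 1
  refine Finset.sum_congr rfl fun k _ => ?_
  rw [← Finset.sum_add_distrib, ← Finset.sum_add_distrib]
  refine Finset.sum_congr rfl fun i _ => ?_
  simp only [Pi.add_apply]
  ring

/-- The moment generating function of a coordinate of the centred sample sum. -/
theorem lintegral_exp_centred_sum (θ : Fin D → ℝ) (i : Fin D) (s : ℝ) :
    ∫⁻ x, ENNReal.ofReal (exp (s * ∑ k, (x k i - θ i))) ∂(iidSamples n (gaussPi θ))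
      = ENNReal.ofReal (exp (n * s ^ 2 / 2)) := by
  rw [iidSamples_eq_withDensity, lintegral_withDensity_eq_lintegral_mul _ (by fun_prop)
    (by fun_prop)]
  have h : ∀ x : Fin n → Fin D → ℝ,
      likelihoodRatio θ x * exp (s * ∑ k, (x k i - θ i))
        = exp (n * s ^ 2 / 2) * likelihoodRatio (θ + Pi.single i s) x := by
    intro x
    have hs : likelihoodRatio (Pi.single i s) x = exp (s * ∑ k, x k i - n * s ^ 2 / 2) := by
      rw [likelihoodRatio]
      congr 1
      rw [Finset.mul_sum]
      have : ∀ k, ∑ j, ((Pi.single i s : Fin D → ℝ) j * x k j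
          - (Pi.single i s : Fin D → ℝ) j ^ 2 / 2) = s * x k i - s ^ 2 / 2 := by
        intro k
        rw [Finset.sum_eq_single i]
        · simp
        · intro j _ hj
          simp [Pi.single_eq_of_ne hj]
        · simp
      simp_rw [this]
      rw [Finset.sum_sub_distrib]
      simp
      ring
    have hm := likelihoodRatio_mul θ (Pi.single i s) x
    have hdot : ∑ j, θ j * (Pi.single i s : Fin D → ℝ) j = θ i * s := by
      simp [Pi.single_apply]
    rw [hs, hdot] at hm
    have he : exp (s * ∑ k, (x k i - θ i))
        = exp (s * ∑ k, x k i - n * s ^ 2 / 2) * exp (-(n * (θ i * s))) * exp (n * s ^ 2 / 2) := by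
      rw [← exp_add, ← exp_add, Finset.sum_sub_distrib]
      congr 1
      simp
      ring
    rw [he, ← mul_assoc, ← mul_assoc, hm]
    have : exp (n * (θ i * s)) * exp (-(n * (θ i * s))) = 1 := by
      rw [← exp_add, add_neg_cancel, exp_zero]
    linear_combination (likelihoodRatio (θ + Pi.single i s) x * exp (n * s ^ 2 / 2)) * this
  have h' : ∀ x : Fin n → Fin D → ℝ, ENNReal.ofReal (likelihoodRatio θ x)
      * ENNReal.ofReal (exp (s * ∑ k, (x k i - θ i))) = ENNReal.ofReal (exp (n * s ^ 2 / 2))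
        * ENNReal.ofReal (likelihoodRatio (θ + Pi.single i s) x) := by
    intro x
    rw [← ENNReal.ofReal_mul (likelihoodRatio_pos θ x).le, h, ENNReal.ofReal_mul (exp_pos _).le]
  simp_rw [Pi.mul_apply, h']
  rw [lintegral_const_mul _ (by fun_prop), lintegral_likelihoodRatio, mul_one]

end LikelihoodRatio

section Testing

variable {D : ℕ}

/-- The finite set `{-1, 1}^D` of sign vectors. -/
noncomputable def signVectors (D : ℕ) : Finset (Fin D → ℝ) :=
  Fintype.piFinset fun _ => ({1, -1} : Finset ℝ)

theorem mem_signVectors {s : Fin D → ℝ} :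
    s ∈ signVectors D ↔ ∀ i, s i = 1 ∨ s i = -1 := by
  simp [signVectors]

theorem card_signVectors : ((signVectors D).card : ℝ) = 2 ^ D := by
  rw [signVectors, Fintype.card_piFinset]
  have : ({1, -1} : Finset ℝ).card = 2 := Finset.card_pair (by norm_num)
  simp [this]

theorem sum_signVectors_exp {s : Fin D → ℝ} (hs : s ∈ signVectors D) (a : Fin D → ℝ) (c : ℝ) :
    ∑ t ∈ signVectors D, exp (c * ∑ i, (s i * a i) * (t i * a i))
      = 2 ^ D * ∏ i, cosh (c * a i ^ 2) := by
  have h : ∀ t : Fin D → ℝ, exp (c * ∑ i, (s i * a i) * (t i * a i))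
      = ∏ i, exp (s i * t i * (c * a i ^ 2)) := by
    intro t
    rw [← exp_sum, Finset.mul_sum]
    congr 1
    exact Finset.sum_congr rfl fun i _ => by ring
  simp_rw [h]
  rw [signVectors, ← Finset.prod_univ_sum (fun _ => ({1, -1} : Finset ℝ))
    (fun i b => exp (s i * b * (c * a i ^ 2)))]
  have h2 : (2 : ℝ) ^ D = ∏ _i : Fin D, (2 : ℝ) := by simp
  rw [h2, ← Finset.prod_mul_distrib]
  refine Finset.prod_congr rfl fun i _ => ?_
  rw [Finset.sum_pair (by norm_num), cosh_eq]
  rcases mem_signVectors.1 hs i with h | h <;> rw [h]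
  · rw [mul_one, one_mul, one_mul, neg_one_mul]
    ring
  · rw [mul_one, neg_one_mul, neg_one_mul, neg_neg, one_mul]
    ring

theorem prod_cosh_le (a : Fin D → ℝ) (c : ℝ) :
    ∏ i, cosh (c * a i ^ 2) ≤ exp (c ^ 2 * (∑ i, a i ^ 4) / 2) := by
  have h : c ^ 2 * (∑ i, a i ^ 4) / 2 = ∑ i, (c * a i ^ 2) ^ 2 / 2 := by
    rw [Finset.mul_sum, Finset.sum_div]
    exact Finset.sum_congr rfl fun i _ => by ring
  rw [h, exp_sum]
  exact Finset.prod_le_prod (fun i _ => (cosh_pos _).le) fun i _ => cosh_le_exp_half_sq _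

/-- The likelihood ratio of the mixture of `N(s θ, I_D)` over uniform signs `s`. -/
noncomputable def mixtureRatio {n : ℕ} (θ : Fin D → ℝ) (x : Fin n → Fin D → ℝ) : ℝ :=
  (2 ^ D)⁻¹ * ∑ s ∈ signVectors D, likelihoodRatio (fun i => s i * θ i) x

variable {n : ℕ}

theorem integrable_mixtureRatio (θ : Fin D → ℝ) :
    Integrable (mixtureRatio θ) (iidSamples n (gaussPi 0)) :=
  (integrable_finsetSum _ fun _ _ => integrable_likelihoodRatio _).const_mul _

theorem integral_mixtureRatio (θ : Fin D → ℝ) :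
    ∫ x, mixtureRatio θ x ∂(iidSamples n (gaussPi 0)) = 1 := by
  unfold mixtureRatio
  rw [integral_const_mul, integral_finsetSum _ fun _ _ => integrable_likelihoodRatio _]
  simp_rw [integral_likelihoodRatio]
  rw [Finset.sum_const, nsmul_eq_mul, card_signVectors, mul_one]
  exact inv_mul_cancel₀ (by positivity)

theorem mixtureRatio_sq (θ : Fin D → ℝ) (x : Fin n → Fin D → ℝ) :
    mixtureRatio θ x ^ 2 = (2 ^ D)⁻¹ ^ 2 * ∑ s ∈ signVectors D, ∑ t ∈ signVectors D,
      exp (n * ∑ i, (s i * θ i) * (t i * θ i))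
        * likelihoodRatio ((fun i => s i * θ i) + fun i => t i * θ i) x := by
  rw [mixtureRatio, mul_pow, sq (∑ s ∈ signVectors D, _), Finset.sum_mul_sum]
  simp_rw [likelihoodRatio_mul]

theorem integrable_mixtureRatio_sq (θ : Fin D → ℝ) :
    Integrable (fun x => mixtureRatio θ x ^ 2) (iidSamples n (gaussPi 0)) := by
  simp_rw [mixtureRatio_sq]
  exact (integrable_finsetSum _ fun _ _ => integrable_finsetSum _ fun _ _ =>
    (integrable_likelihoodRatio _).const_mul _).const_mul _

theorem integral_mixtureRatio_sq_le (θ : Fin D → ℝ) :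
    ∫ x, mixtureRatio θ x ^ 2 ∂(iidSamples n (gaussPi 0))
      ≤ exp (n ^ 2 * (∑ i, θ i ^ 4) / 2) := by
  refine le_trans (le_of_eq ?_) (prod_cosh_le θ n)
  simp_rw [mixtureRatio_sq]
  rw [integral_const_mul, integral_finsetSum _ fun _ _ => integrable_finsetSum _ fun _ _ =>
    (integrable_likelihoodRatio _).const_mul _]
  have h : ∀ s ∈ signVectors D, ∫ x : Fin n → Fin D → ℝ, ∑ t ∈ signVectors D,
      exp (n * ∑ i, (s i * θ i) * (t i * θ i))
        * likelihoodRatio ((fun i => s i * θ i) + fun i => t i * θ i) x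
        ∂(iidSamples n (gaussPi 0)) = 2 ^ D * ∏ i, cosh (n * θ i ^ 2) := by
    intro s hs
    rw [integral_finsetSum _ fun _ _ => (integrable_likelihoodRatio _).const_mul _,
      ← sum_signVectors_exp hs]
    refine Finset.sum_congr rfl fun t _ => ?_
    rw [integral_const_mul, integral_likelihoodRatio, mul_one]
  rw [Finset.sum_congr rfl h, Finset.sum_const, nsmul_eq_mul, card_signVectors]
  field_simp

theorem setIntegral_mixtureRatio_le (θ : Fin D → ℝ) {A : Set (Fin n → Fin D → ℝ)}
    (hA : MeasurableSet A) {c : ℝ}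
    (h : ∀ s ∈ signVectors D, (iidSamples n (gaussPi fun i => s i * θ i)).real A ≤ c) :
    ∫ x in A, mixtureRatio θ x ∂(iidSamples n (gaussPi 0)) ≤ c := by
  unfold mixtureRatio
  rw [integral_const_mul,
    integral_finsetSum _ fun _ _ => (integrable_likelihoodRatio _).integrableOn]
  simp_rw [setIntegral_likelihoodRatio _ hA]
  calc (2 ^ D)⁻¹ * ∑ s ∈ signVectors D, (iidSamples n (gaussPi fun i => s i * θ i)).real A
      ≤ (2 ^ D)⁻¹ * ∑ s ∈ signVectors D, c := by gcongr with s hs; exact h s hs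
    _ = c := by
      rw [Finset.sum_const, nsmul_eq_mul, card_signVectors]
      field_simp

/-- If some test separates `N(0, I_D)` from all sign flips of `θ` with `n` samples, then the
fourth moments of `θ` are large. -/
theorem exp_fourth_moment_of_test (θ : Fin D → ℝ) (ψ : (Fin n → Fin D → ℝ) → Bool)
    (hψ : Measurable ψ) (h₀ : iidSamples n (gaussPi (0 : Fin D → ℝ)) {x | ψ x = true} ≤ 1 / 4)
    (h₁ : ∀ s ∈ signVectors D,
      iidSamples n (gaussPi fun i => s i * θ i) {x | ψ x = false} ≤ 1 / 4) :
    5 / 4 ≤ exp (n ^ 2 * (∑ i, θ i ^ 4) / 2) := by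
  set P := iidSamples n (gaussPi (0 : Fin D → ℝ)) with hP
  set A := {x | ψ x = false} with hAdef
  have hA : MeasurableSet A := hψ (measurableSet_singleton false)
  have hreal : ∀ p : ENNReal, p ≤ 1 / 4 → p.toReal ≤ 1 / 4 := fun p hp => by
    have := ENNReal.toReal_mono (by simp) hp
    simpa using this
  have hmix := setIntegral_mixtureRatio_le θ hA (c := 1 / 4) fun s hs => hreal _ (h₁ s hs)
  have hPA : 3 / 4 ≤ P.real A := by
    have hc : Aᶜ = {x | ψ x = true} := by
      ext x
      simp [hAdef]
    have := hreal _ h₀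
    rw [← hc] at this
    have h := probReal_compl_eq_one_sub (μ := P) hA
    rw [Measure.real] at h
    linarith
  have hint : Integrable (fun x => 1 - mixtureRatio θ x) P :=
    (integrable_const 1).sub (integrable_mixtureRatio θ)
  have hint2 : Integrable (fun x => mixtureRatio θ x ^ 2 - 2 * mixtureRatio θ x + 5 / 4) P :=
    ((integrable_mixtureRatio_sq θ).sub ((integrable_mixtureRatio θ).const_mul 2)).add
      (integrable_const _)
  have hsub : ∫ x in A, (1 - mixtureRatio θ x) ∂P
      = P.real A - ∫ x in A, mixtureRatio θ x ∂P := by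
    rw [integral_sub (integrable_const 1).integrableOn (integrable_mixtureRatio θ).integrableOn]
    simp [hP]
  have hle : ∫ x in A, (1 - mixtureRatio θ x) ∂P
      ≤ ∫ x, (mixtureRatio θ x ^ 2 - 2 * mixtureRatio θ x + 5 / 4) ∂P := by
    calc ∫ x in A, (1 - mixtureRatio θ x) ∂P
        ≤ ∫ x in A, (mixtureRatio θ x ^ 2 - 2 * mixtureRatio θ x + 5 / 4) ∂P := by
          refine integral_mono hint.integrableOn hint2.integrableOn fun x => ?_
          dsimp only
          nlinarith [sq_nonneg (mixtureRatio θ x - 1 / 2)]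
      _ ≤ _ := setIntegral_le_integral hint2 (.of_forall fun x => by
          dsimp only [Pi.zero_apply]
          nlinarith [sq_nonneg (mixtureRatio θ x - 1)])
  have heq : ∫ x, (mixtureRatio θ x ^ 2 - 2 * mixtureRatio θ x + 5 / 4) ∂P
      = ∫ x, mixtureRatio θ x ^ 2 ∂P - 3 / 4 := by
    have hdiff : Integrable (fun x => mixtureRatio θ x ^ 2 - 2 * mixtureRatio θ x) P :=
      (integrable_mixtureRatio_sq θ).sub ((integrable_mixtureRatio θ).const_mul 2)
    rw [integral_add hdiff (integrable_const _), hP,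
      integral_sub (integrable_mixtureRatio_sq θ) ((integrable_mixtureRatio θ).const_mul 2),
      integral_const_mul, integral_mixtureRatio]
    simp
    ring
  have hsq := integral_mixtureRatio_sq_le (n := n) θ
  rw [← hP] at hsq
  linarith

end Testing

section UpperBounds

variable {D n : ℕ}

theorem lintegral_exp_centred_sum_add (θ : Fin D → ℝ) (i : Fin D) (s : ℝ) :
    ∫⁻ x, ENNReal.ofReal (exp (s * ∑ k, (x k i - θ i)) + exp (-s * ∑ k, (x k i - θ i)))
        ∂(iidSamples n (gaussPi θ))
      = ENNReal.ofReal (2 * exp (n * s ^ 2 / 2)) := by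
  simp_rw [fun x : Fin n → Fin D → ℝ =>
    ENNReal.ofReal_add (exp_pos (s * ∑ k, (x k i - θ i))).le
      (exp_pos (-s * ∑ k, (x k i - θ i))).le]
  rw [lintegral_add_left (by fun_prop), lintegral_exp_centred_sum, lintegral_exp_centred_sum,
    neg_sq, ← ENNReal.ofReal_add (exp_pos _).le (exp_pos _).le, two_mul]

theorem measure_centred_sum_ge_le (θ : Fin D → ℝ) (i : Fin D) {r : ℝ} (hr : 0 ≤ r) :
    iidSamples n (gaussPi θ) {x | n * r ≤ |∑ k, (x k i - θ i)|}
      ≤ ENNReal.ofReal (2 * exp (-(n * r ^ 2 / 2))) := by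
  set f : (Fin n → Fin D → ℝ) → ENNReal := fun x => ENNReal.ofReal (exp (-(n * r ^ 2)))
    * ENNReal.ofReal (exp (r * ∑ k, (x k i - θ i)) + exp (-r * ∑ k, (x k i - θ i))) with hf
  have hsub : {x : Fin n → Fin D → ℝ | n * r ≤ |∑ k, (x k i - θ i)|} ⊆ {x | 1 ≤ f x} := by
    intro x hx
    simp only [Set.mem_ofPred_eq] at hx ⊢
    rw [hf]
    dsimp only
    rw [← ENNReal.ofReal_mul (exp_pos _).le, ← ENNReal.ofReal_one]
    refine ENNReal.ofReal_le_ofReal ?_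
    have h1 := exp_abs_le (r * ∑ k, (x k i - θ i))
    rw [abs_mul, abs_of_nonneg hr, ← neg_mul] at h1
    calc (1 : ℝ) ≤ exp (-(n * r ^ 2)) * exp (r * |∑ k, (x k i - θ i)|) := by
          rw [← exp_add, one_le_exp_iff]
          nlinarith
      _ ≤ _ := by gcongr
  have hmk := mul_meas_ge_le_lintegral (μ := iidSamples n (gaussPi θ)) (f := f) (by fun_prop) 1
  rw [one_mul] at hmk
  refine (measure_mono hsub).trans (hmk.trans (le_of_eq ?_))
  rw [hf, lintegral_const_mul _ (by fun_prop), lintegral_exp_centred_sum_add,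
    ← ENNReal.ofReal_mul (exp_pos _).le]
  congr 1
  rw [mul_left_comm, ← exp_add]
  ring_nf

/-- A maximum test detects every mean of norm at least `ε` once the sample is large enough. -/
theorem exists_gof_test (hD : 0 < D) (Γ : Set (Fin D → ℝ)) {ε : ℝ} (hε : 0 < ε) :
    {n : ℕ | ∃ ψ : (Fin n → (Fin D → ℝ)) → Bool, Measurable ψ ∧
      (iidSamples n (gaussPi (0 : Fin D → ℝ))) {x | ψ x = true} ≤ 1/4 ∧
      ∀ θ ∈ Γ, ε ≤ euclNorm θ →
        (iidSamples n (gaussPi θ)) {x | ψ x = false} ≤ 1/4}.Nonempty := by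
  classical
  have hD' : (1 : ℝ) ≤ D := by exact_mod_cast hD
  set r : ℝ := ε / (2 * √D) with hr
  have hr0 : 0 < r := by positivity
  obtain ⟨n, hn⟩ := exists_nat_gt (8 * D * (2 / r ^ 2))
  have htail : D * (2 * exp (-(n * r ^ 2 / 2))) ≤ 1 / 4 := by
    have h1 : 8 * D < n * r ^ 2 / 2 := by
      have := mul_lt_mul_of_pos_right hn (by positivity : 0 < r ^ 2 / 2)
      field_simp at this ⊢
      linarith
    have h2 : exp (-(n * r ^ 2 / 2)) ≤ (8 * (D : ℝ))⁻¹ := by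
      rw [exp_neg]
      gcongr
      linarith [add_one_le_exp (n * r ^ 2 / 2)]
    calc D * (2 * exp (-(n * r ^ 2 / 2))) ≤ D * (2 * (8 * (D : ℝ))⁻¹) := by gcongr
      _ = 1 / 4 := by field_simp; norm_num
  have htail' : D * ENNReal.ofReal (2 * exp (-(n * r ^ 2 / 2))) ≤ 1 / 4 := by
    rw [← ENNReal.ofReal_natCast, ← ENNReal.ofReal_mul (Nat.cast_nonneg D)]
    refine (ENNReal.ofReal_le_ofReal htail).trans (le_of_eq ?_)
    rw [ENNReal.ofReal_div_of_pos (by norm_num)]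
    simp
  have hone : ENNReal.ofReal (2 * exp (-(n * r ^ 2 / 2))) ≤ 1 / 4 := by
    refine le_trans (le_mul_of_one_le_left' ?_) htail'
    exact_mod_cast hD
  set R : Set (Fin n → Fin D → ℝ) := ⋃ i, {x | n * r ≤ |∑ k, x k i|} with hR
  have hRm : MeasurableSet R := by
    refine MeasurableSet.iUnion fun i => measurableSet_le (by fun_prop) ?_
    exact (Finset.measurable_fun_sum _ fun k _ => by fun_prop).abs
  refine ⟨n, fun x => decide (x ∈ R), ?_, ?_, ?_⟩
  · exact measurable_to_bool (by simpa [Set.preimage] using hRm)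
  · have hset : {x | decide (x ∈ R) = true} = R := by ext; simp
    rw [hset]
    refine (measure_iUnion_le _).trans (le_trans ?_ htail')
    rw [tsum_fintype]
    calc _ ≤ ∑ _i : Fin D, ENNReal.ofReal (2 * exp (-(n * r ^ 2 / 2))) := by
          refine Finset.sum_le_sum fun i _ => ?_
          simpa using measure_centred_sum_ge_le (n := n) (0 : Fin D → ℝ) i hr0.le
      _ = _ := by simp
  · intro θ _ hθ
    obtain ⟨i, hi⟩ : ∃ i, 2 * r ≤ |θ i| := by
      by_contra! hcon
      have hlt : ∑ i, θ i ^ 2 < ε ^ 2 := by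
        calc ∑ i, θ i ^ 2 < ∑ _i : Fin D, (2 * r) ^ 2 := by
              refine Finset.sum_lt_sum_of_nonempty ⟨⟨0, hD⟩, Finset.mem_univ _⟩ fun i _ => ?_
              exact sq_lt_sq.2 (by rw [abs_of_pos (by positivity : 0 < 2 * r)]; exact hcon i)
          _ = ε ^ 2 := by
              rw [Finset.sum_const, Finset.card_univ, Fintype.card_fin, nsmul_eq_mul, hr]
              have := sq_sqrt (Nat.cast_nonneg D : (0 : ℝ) ≤ D)
              field_simp
              linarith
      have : euclNorm θ < ε := (sqrt_lt' hε).2 hlt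
      linarith
    refine le_trans (measure_mono ?_) ((measure_centred_sum_ge_le (n := n) θ i hr0.le).trans hone)
    intro x hx
    simp only [Set.mem_ofPred_eq, decide_eq_false_iff_not, hR, Set.mem_iUnion, not_exists,
      not_le] at hx ⊢
    have hxi := hx i
    have hsum : ∑ k, (x k i - θ i) = ∑ k, x k i - n * θ i := by simp [Finset.sum_sub_distrib]
    rw [hsum]
    have h1 := abs_sub_abs_le_abs_sub (n * θ i) (∑ k, x k i)
    rw [abs_sub_comm, abs_mul, Nat.abs_cast] at h1
    have h2 : n * (2 * r) ≤ n * |θ i| := by gcongr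
    linarith

/-- Soft thresholding at level `t`. -/
noncomputable def softThreshold (t y : ℝ) : ℝ := y - max (-t) (min t y)

@[fun_prop]
theorem measurable_softThreshold (t : ℝ) : Measurable (softThreshold t) := by
  unfold softThreshold
  fun_prop

theorem abs_softThreshold_sub_le {t : ℝ} (ht : 0 ≤ t) (a z : ℝ) :
    |softThreshold t (a + z) - a| ≤ min |a| (2 * t) + max (|z| - t) 0 := by
  unfold softThreshold
  rcases max_cases (-t) (min t (a + z)) with ⟨h1, h1'⟩ | ⟨h1, h1'⟩ <;>
  rcases min_cases t (a + z) with ⟨h2, h2'⟩ | ⟨h2, h2'⟩ <;>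
  rcases min_cases |a| (2 * t) with ⟨h3, h3'⟩ | ⟨h3, h3'⟩ <;>
  rcases max_cases (|z| - t) 0 with ⟨h4, h4'⟩ | ⟨h4, h4'⟩ <;>
  rw [abs_le] <;> rw [h3, h4] <;> simp only [h2] at * <;>
  rcases abs_cases a with ⟨h5, h5'⟩ | ⟨h5, h5'⟩ <;>
  rcases abs_cases z with ⟨h6, h6'⟩ | ⟨h6, h6'⟩ <;>
  constructor <;> linarith

theorem max_zero_sq_le_exp (u : ℝ) : max u 0 ^ 2 ≤ 2 * exp u := by
  rcases le_total u 0 with h | h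
  · rw [max_eq_right h]
    nlinarith [exp_pos u]
  · rw [max_eq_left h]
    nlinarith [quadratic_le_exp_of_nonneg h]

theorem softThreshold_sub_sq_le {t : ℝ} (ht : 0 ≤ t) {c : ℝ} (hc : 0 < c) (a z : ℝ) :
    (softThreshold t (a + z) - a) ^ 2 ≤ 3 / 2 * min (a ^ 2) (4 * t ^ 2)
      + 6 / c ^ 2 * exp (-(c * t)) * (exp (c * z) + exp (-(c * z))) := by
  set p := min |a| (2 * t) with hp
  set q := max (|z| - t) 0 with hq
  have hp0 : 0 ≤ p := le_min (abs_nonneg a) (by linarith)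
  have hq0 : 0 ≤ q := le_max_right _ _
  have hpsq : p ^ 2 ≤ min (a ^ 2) (4 * t ^ 2) := by
    refine le_min ?_ ?_
    · rw [← sq_abs a]
      exact pow_le_pow_left₀ hp0 (min_le_left _ _) 2
    · have := pow_le_pow_left₀ hp0 (min_le_right |a| (2 * t)) 2
      linarith
  have hqsq : q ^ 2 ≤ 2 / c ^ 2 * exp (-(c * t)) * (exp (c * z) + exp (-(c * z))) := by
    have h1 := max_zero_sq_le_exp (c * (|z| - t))
    have h2 : max (c * (|z| - t)) 0 = c * q := by
      rw [hq, mul_max_of_nonneg _ _ hc.le, mul_zero]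
    have h3 := exp_abs_le (c * z)
    rw [abs_mul, abs_of_pos hc] at h3
    have h4 : exp (c * (|z| - t)) = exp (-(c * t)) * exp (c * |z|) := by
      rw [← exp_add]
      ring_nf
    rw [h2, h4, mul_pow] at h1
    have h5 : q ^ 2 ≤ 2 / c ^ 2 * exp (-(c * t)) * exp (c * |z|) := by
      rw [div_mul_eq_mul_div, div_mul_eq_mul_div, le_div_iff₀ (by positivity)]
      linarith
    exact h5.trans (by gcongr)
  have hsq : (softThreshold t (a + z) - a) ^ 2 ≤ (p + q) ^ 2 := by
    rw [← sq_abs (softThreshold t (a + z) - a)]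
    exact pow_le_pow_left₀ (abs_nonneg _) (abs_softThreshold_sub_le ht a z) 2
  have hyoung : (p + q) ^ 2 ≤ 3 / 2 * p ^ 2 + 3 * q ^ 2 := by
    nlinarith [sq_nonneg (p - 2 * q)]
  have : 6 / c ^ 2 * exp (-(c * t)) * (exp (c * z) + exp (-(c * z)))
      = 3 * (2 / c ^ 2 * exp (-(c * t)) * (exp (c * z) + exp (-(c * z)))) := by ring
  rw [this]
  linarith

/-- The risk of coordinatewise soft thresholding of the sample mean. -/
theorem lintegral_softThreshold_risk_le (hn : 0 < n) {t : ℝ} (ht : 0 < t) (θ : Fin D → ℝ) :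
    ∫⁻ x, ENNReal.ofReal (∑ i, (softThreshold t ((∑ k, x k i) / n) - θ i) ^ 2)
        ∂(iidSamples n (gaussPi θ))
      ≤ ENNReal.ofReal (3 / 2 * ∑ i, min (θ i ^ 2) (4 * t ^ 2)
        + D * (12 / (n * t) ^ 2 * exp (-(n * t ^ 2 / 2)))) := by
  have hn' : (0 : ℝ) < n := by exact_mod_cast hn
  set B := 6 / (n * t) ^ 2 * exp (-(n * t * t)) with hB
  have hB0 : 0 ≤ B := by positivity
  have hmin : 0 ≤ 3 / 2 * ∑ i, min (θ i ^ 2) (4 * t ^ 2) :=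
    mul_nonneg (by norm_num) (Finset.sum_nonneg fun i _ => le_min (by positivity) (by positivity))
  have hpt : ∀ x : Fin n → Fin D → ℝ,
      ENNReal.ofReal (∑ i, (softThreshold t ((∑ k, x k i) / n) - θ i) ^ 2)
        ≤ ENNReal.ofReal (3 / 2 * ∑ i, min (θ i ^ 2) (4 * t ^ 2)) + ∑ i, ENNReal.ofReal B
          * ENNReal.ofReal (exp (t * ∑ k, (x k i - θ i)) + exp (-t * ∑ k, (x k i - θ i))) := by
    intro x
    simp_rw [← ENNReal.ofReal_mul hB0]
    rw [← ENNReal.ofReal_sum_of_nonneg fun i _ => by positivity,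
      ← ENNReal.ofReal_add hmin (Finset.sum_nonneg fun i _ => by positivity)]
    refine ENNReal.ofReal_le_ofReal ?_
    rw [Finset.mul_sum, ← Finset.sum_add_distrib]
    refine Finset.sum_le_sum fun i _ => ?_
    have h := softThreshold_sub_sq_le ht.le (mul_pos hn' ht) (θ i) ((∑ k, (x k i - θ i)) / n)
    have h1 : θ i + (∑ k, (x k i - θ i)) / n = (∑ k, x k i) / n := by
      rw [Finset.sum_sub_distrib]
      simp
      field_simp
      ring
    have h2 : n * t * ((∑ k, (x k i - θ i)) / n) = t * ∑ k, (x k i - θ i) := by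
      field_simp
    rw [h1, h2] at h
    rw [neg_mul t]
    exact h
  refine (lintegral_mono hpt).trans (le_of_eq ?_)
  rw [lintegral_add_left measurable_const, lintegral_finsetSum _ (by fun_prop)]
  simp_rw [lintegral_const_mul' _ _ ENNReal.ofReal_ne_top, lintegral_exp_centred_sum_add]
  rw [lintegral_const, measure_univ, mul_one, Finset.sum_const, Finset.card_univ, Fintype.card_fin,
    nsmul_eq_mul, ← ENNReal.ofReal_mul hB0, ← ENNReal.ofReal_natCast,
    ← ENNReal.ofReal_mul (Nat.cast_nonneg D), ← ENNReal.ofReal_add hmin (by positivity)]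
  congr 3
  have he : exp (-(n * t ^ 2 / 2)) = exp (-(n * t * t)) * exp (n * t ^ 2 / 2) := by
    rw [← exp_add]
    ring_nf
  rw [hB, he]
  ring

end UpperBounds

section Orthosymmetric

variable {D : ℕ} {Γ : Set (Fin D → ℝ)}

theorem Orthosymmetric.update_mem (horth : Orthosymmetric Γ) (hconv : Convex ℝ Γ)
    {θ : Fin D → ℝ} (hθ : θ ∈ Γ) (j : Fin D) {a : ℝ} (ha : |a| ≤ |θ j|) :
    Function.update θ j a ∈ Γ := by
  rcases eq_or_ne (θ j) 0 with h0 | h0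
  · rw [h0, abs_zero, abs_nonpos_iff] at ha
    rwa [ha, ← h0, Function.update_eq_self]
  have hflip : Function.update θ j (-θ j) ∈ Γ := by
    have h := horth θ hθ (Function.update 1 j (-1)) fun i => by
      rcases eq_or_ne i j with rfl | h <;> simp [*]
    convert h using 1
    ext i
    rcases eq_or_ne i j with rfl | h <;> simp [*]
  have hq : |a / θ j| ≤ 1 := by
    rw [abs_div]
    exact div_le_one_of_le₀ ha (abs_nonneg _)
  obtain ⟨hq1, hq2⟩ := abs_le.1 hq
  have h := hconv hθ hflip (a := (1 + a / θ j) / 2) (b := (1 - a / θ j) / 2)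
    (by linarith) (by linarith) (by ring)
  convert h using 1
  ext i
  rcases eq_or_ne i j with rfl | h
  · simp
    field_simp
    ring
  · simp [h]
    ring

/-- A convex orthosymmetric set is solid. -/
theorem Orthosymmetric.mem_of_abs_le (horth : Orthosymmetric Γ) (hconv : Convex ℝ Γ)
    {θ θ' : Fin D → ℝ} (hθ : θ ∈ Γ) (h : ∀ i, |θ' i| ≤ |θ i|) : θ' ∈ Γ := by
  classical
  have key : ∀ s : Finset (Fin D), s.piecewise θ' θ ∈ Γ := by
    intro s
    induction s using Finset.induction_on with
    | empty => simpa using hθ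
    | insert j s hj ih =>
      rw [Finset.piecewise_insert]
      exact horth.update_mem hconv ih j (by simpa [hj] using h j)
  simpa using key Finset.univ

/-- If `m` samples suffice to test at separation `ε / √2`, then every element of `Γ` has small
energy after clipping its coordinates at level `τ`. -/
theorem sum_min_sq_le_of_test (hconv : Convex ℝ Γ) (horth : Orthosymmetric Γ) {ε : ℝ}
    (hε : 0 < ε) {m : ℕ}
    (hfourth : ∀ θ ∈ Γ, ε / √2 ≤ euclNorm θ → 5 / 4 ≤ exp (m ^ 2 * (∑ i, θ i ^ 4) / 2))
    {τ : ℝ} (hτ : 0 ≤ τ) (hτm : m ^ 2 * τ ^ 2 * ε ^ 2 ≤ 1 / 2) {θ : Fin D → ℝ} (hθ : θ ∈ Γ) :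
    ∑ i, min (θ i ^ 2) (τ ^ 2) ≤ ε ^ 2 / 2 := by
  by_contra! hcon
  set S := ∑ i, min (θ i ^ 2) (τ ^ 2) with hS
  have hS0 : 0 < S := lt_trans (by positivity) hcon
  set t := ε ^ 2 / (2 * S) with ht
  have ht0 : 0 ≤ t := by positivity
  have ht1 : t ≤ 1 := by
    rw [ht, div_le_one (by positivity)]
    linarith
  set θ' : Fin D → ℝ := fun i => √t * min |θ i| τ with hθ'
  have hsq : ∀ i, θ' i ^ 2 = t * min (θ i ^ 2) (τ ^ 2) := by
    intro i
    rw [hθ', mul_pow, sq_sqrt ht0]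
    congr 1
    rcases le_total |θ i| τ with h | h
    · rw [min_eq_left h, sq_abs, min_eq_left (by
        rw [← sq_abs]
        exact pow_le_pow_left₀ (abs_nonneg _) h 2)]
    · rw [min_eq_right h, min_eq_right (by
        rw [← sq_abs (θ i)]
        exact pow_le_pow_left₀ hτ h 2)]
  have hmem : θ' ∈ Γ := by
    refine horth.mem_of_abs_le hconv hθ fun i => ?_
    rw [hθ', abs_mul, abs_of_nonneg (sqrt_nonneg t), abs_of_nonneg (le_min (abs_nonneg _) hτ)]
    calc √t * min |θ i| τ ≤ 1 * |θ i| := by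
          gcongr
          · exact sqrt_le_one.2 ht1
          · exact min_le_left _ _
      _ = |θ i| := one_mul _
  have hsum : ∑ i, θ' i ^ 2 = ε ^ 2 / 2 := by
    simp_rw [hsq]
    rw [← Finset.mul_sum, ← hS, ht]
    field_simp
  have hnorm : ε / √2 ≤ euclNorm θ' := by
    rw [euclNorm, hsum, sqrt_div (by positivity), sqrt_sq hε.le]
  have hquart : ∑ i, θ' i ^ 4 ≤ τ ^ 2 * (ε ^ 2 / 2) := by
    rw [← hsum, Finset.mul_sum]
    refine Finset.sum_le_sum fun i _ => ?_
    have h1 : θ' i ^ 2 ≤ τ ^ 2 := by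
      rw [hsq]
      calc t * min (θ i ^ 2) (τ ^ 2) ≤ 1 * τ ^ 2 := by
            gcongr
            exact min_le_right _ _
        _ = τ ^ 2 := one_mul _
    nlinarith [sq_nonneg (θ' i)]
  have hexp : m ^ 2 * (∑ i, θ' i ^ 4) / 2 ≤ 1 / 8 := by
    have := mul_le_mul_of_nonneg_left hquart (by positivity : (0 : ℝ) ≤ m ^ 2)
    linarith
  have h1 := (hfourth θ' hmem hnorm).trans (exp_le_exp.2 hexp)
  have h2 : exp (1 / 8 : ℝ) < 5 / 4 := by
    have h3 : exp (1 / 8 : ℝ) ^ 8 < (5 / 4) ^ 8 := by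
      rw [← exp_nat_mul]
      norm_num
      linarith [exp_one_lt_d9]
    exact lt_of_pow_lt_pow_left₀ 8 (by norm_num) h3
  linarith

end Orthosymmetric

/-- For a compact, convex, orthosymmetric `Γ ⊆ ℝ^D`,
`n_gof(Γ, ε/√2)² ≥ (1/(64 log(2D))) · n_est(Γ, ε)/ε²`. -/
theorem gof_lower_bound_from_est {D : ℕ} (hD : 0 < D) (Γ : Set (Fin D → ℝ))
    (hcomp : IsCompact Γ) (hconv : Convex ℝ Γ) (horth : Orthosymmetric Γ)
    (ε : ℝ) (hε : 0 < ε) :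
    (1 / (64 * Real.log (2 * D))) * ((nEst Γ ε : ℝ) / ε ^ 2)
      ≤ (nGof Γ (ε / Real.sqrt 2) : ℝ) ^ 2 := by
  set m := nGof Γ (ε / √2) with hm
  set L := log (2 * D) with hL
  have hD' : (1 : ℝ) ≤ D := by exact_mod_cast hD
  have hL0 : 0.69 < L := by
    have : log 2 ≤ L := log_le_log (by norm_num) (by linarith)
    linarith [log_two_gt_d9]
  rcases Nat.eq_zero_or_pos (nEst Γ ε) with h0 | hpos
  · rw [h0]
    simp only [Nat.cast_zero, zero_div, mul_zero]
    positivity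
  -- The zero estimator without samples fails, so `Γ` has an element of norm above `ε`.
  obtain ⟨θ₀, hθ₀, hbig⟩ : ∃ θ ∈ Γ, ε ^ 2 < ∑ i, θ i ^ 2 := by
    by_contra! hcon
    have : nEst Γ ε ≤ 0 := Nat.sInf_le ⟨fun _ => 0, measurable_const, fun θ hθ => by
      simpa using ENNReal.ofReal_le_ofReal (hcon θ hθ)⟩
    omega
  have hε2 : 0 < ε / √2 := by positivity
  obtain ⟨ψ, hψ, hψ₀, hψ₁⟩ := Nat.sInf_mem (exists_gof_test hD Γ hε2)
  have hfourth : ∀ θ ∈ Γ, ε / √2 ≤ euclNorm θ → 5 / 4 ≤ exp (m ^ 2 * (∑ i, θ i ^ 4) / 2) := by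
    intro θ hθ hnorm
    refine exp_fourth_moment_of_test θ ψ hψ hψ₀ fun s hs => ?_
    have hs' := mem_signVectors.1 hs
    refine hψ₁ _ (horth θ hθ s hs') (hnorm.trans (le_of_eq ?_))
    unfold euclNorm
    congr 1
    refine Finset.sum_congr rfl fun i _ => ?_
    rcases hs' i with h | h <;> simp [h]
  have hm1 : (1 : ℝ) ≤ m := by
    rcases Nat.eq_zero_or_pos m with h | h
    · have h1 := hfourth θ₀ hθ₀ <| by
        refine le_trans ?_ (le_sqrt_of_sq_le hbig.le)
        exact div_le_self hε.le (one_le_sqrt.2 (by norm_num))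
      rw [h] at h1
      norm_num at h1
    · exact_mod_cast h
  set τ : ℝ := √(1 / (2 * m ^ 2 * ε ^ 2)) with hτ
  have hτsq : τ ^ 2 = 1 / (2 * m ^ 2 * ε ^ 2) := sq_sqrt (by positivity)
  have hτ0 : 0 < τ := sqrt_pos.2 (by positivity)
  have hclip : ∀ θ ∈ Γ, ∑ i, min (θ i ^ 2) (τ ^ 2) ≤ ε ^ 2 / 2 := fun θ hθ => by
    refine sum_min_sq_le_of_test hconv horth hε hfourth hτ0.le ?_ hθ
    rw [hτsq]
    apply le_of_eq
    field_simp
  have hτε : τ ^ 2 ≤ ε ^ 2 / 2 := by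
    obtain ⟨j, hj⟩ : ∃ j, τ ^ 2 < θ₀ j ^ 2 := by
      by_contra! hcon
      have := hclip θ₀ hθ₀
      rw [Finset.sum_congr rfl fun i _ => min_eq_left (hcon i)] at this
      nlinarith [sq_pos_of_pos hε]
    refine (min_eq_right hj.le).ge.trans (le_trans ?_ (hclip θ₀ hθ₀))
    refine Finset.single_le_sum (f := fun i => min (θ₀ i ^ 2) (τ ^ 2)) (fun i _ => ?_)
      (Finset.mem_univ j)
    exact le_min (by positivity) (by positivity)
  have hmε : 1 ≤ m * ε ^ 2 := by
    rw [hτsq, div_le_div_iff₀ (by positivity) (by positivity)] at hτε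
    have : 1 ≤ (m * ε ^ 2) ^ 2 := by nlinarith
    nlinarith [mul_pos (by linarith : (0 : ℝ) < m) (sq_pos_of_pos hε)]
  have hm2ε : 1 ≤ m ^ 2 * ε ^ 2 := by nlinarith
  set n := ⌊64 * L * (m ^ 2 * ε ^ 2)⌋₊ with hn
  have hnle : (n : ℝ) ≤ 64 * L * (m ^ 2 * ε ^ 2) := Nat.floor_le (by positivity)
  have hnge : 32 * L * (m ^ 2 * ε ^ 2) ≤ n := by
    have := Nat.lt_floor_add_one (64 * L * (m ^ 2 * ε ^ 2))
    nlinarith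
  have hn0 : (0 : ℝ) < n := lt_of_lt_of_le (by positivity) hnge
  have hest : nEst Γ ε ≤ n := by
    refine Nat.sInf_le ⟨fun x i => softThreshold (τ / 2) ((∑ k, x k i) / n), ?_, fun θ hθ => ?_⟩
    · fun_prop
    refine (lintegral_softThreshold_risk_le (by exact_mod_cast hn0) (by positivity) θ).trans
      (ENNReal.ofReal_le_ofReal ?_)
    have h4 : 4 * (τ / 2) ^ 2 = τ ^ 2 := by ring
    rw [h4]
    have hc := hclip θ hθ
    have hnτ : 4 * L ≤ n * (τ / 2) ^ 2 := by
      have : n * (τ / 2) ^ 2 = n / (8 * (m ^ 2 * ε ^ 2)) := by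
        rw [div_pow, hτsq]
        field_simp
        norm_num
      rw [this, le_div_iff₀ (by positivity)]
      linarith
    have hexp : D * exp (-(n * (τ / 2) ^ 2 / 2)) ≤ 1 / 2 := by
      have h1 : exp (-(n * (τ / 2) ^ 2 / 2)) ≤ exp (-L) := exp_le_exp.2 (by linarith)
      have h2 : exp (-L) = (2 * (D : ℝ))⁻¹ := by rw [exp_neg, hL, exp_log (by positivity)]
      rw [h2] at h1
      calc D * exp (-(n * (τ / 2) ^ 2 / 2)) ≤ D * (2 * (D : ℝ))⁻¹ := by gcongr
        _ = 1 / 2 := by field_simp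
    have hnε : 32 * L ≤ n * ε ^ 2 := by
      have h1 : 32 * L * (m ^ 2 * ε ^ 2) * ε ^ 2 ≤ n * ε ^ 2 := by gcongr
      have h2 : 1 ≤ (m * ε ^ 2) ^ 2 := one_le_pow₀ hmε
      nlinarith
    have hquad : 24 ≤ (n * (τ / 2)) ^ 2 * ε ^ 2 := by
      have h1 : (n * (τ / 2)) ^ 2 * ε ^ 2 = (n * (τ / 2) ^ 2) * (n * ε ^ 2) := by ring
      have h2 : 4 * L * (32 * L) ≤ (n * (τ / 2) ^ 2) * (n * ε ^ 2) := by gcongr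
      nlinarith
    have htail : 12 / (n * (τ / 2)) ^ 2 ≤ ε ^ 2 / 2 := by
      rw [div_le_div_iff₀ (by positivity) (by positivity)]
      linarith
    have hlast : D * (12 / (n * (τ / 2)) ^ 2 * exp (-(n * (τ / 2) ^ 2 / 2))) ≤ ε ^ 2 / 4 := by
      calc D * (12 / (n * (τ / 2)) ^ 2 * exp (-(n * (τ / 2) ^ 2 / 2)))
          = 12 / (n * (τ / 2)) ^ 2 * (D * exp (-(n * (τ / 2) ^ 2 / 2))) := by ring
        _ ≤ ε ^ 2 / 2 * (1 / 2) := by gcongr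
        _ = ε ^ 2 / 4 := by ring
    linarith
  have hest' : (nEst Γ ε : ℝ) ≤ 64 * L * (m ^ 2 * ε ^ 2) :=
    le_trans (by exact_mod_cast hest) hnle
  rw [div_mul_div_comm, one_mul, div_le_iff₀ (by positivity)]
  linarith
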